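/- Let R be a finite valuation ring with uniformizer z, nilpotency degree r, and residue field of cardinality q. For all w, s ∈ R: if s lies in the ideal generated by w, then the number of v ∈ R with w·v = s equals q^{ν(w)}; if s does not lie in the ideal generated by w, then there is no v ∈ R with w·v = s. -/

import Mathlib

open Classical

/-- The natural valuation on a finite valuation ring with uniformizer `z` and nilpotency
degree `r`: `ν 0 = r`, and for `x ≠ 0`, `ν x` is the unique `k` with
`x ∈ (z^k) \ (z^(k+1))`, i.e. the least `k` with `x ∉ (z^(k+1))`. -/
noncomputable def nuVal {R : Type*} [CommRing R] (z : R) (r : ℕ) (x : R) : ℕ :=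
  if x = 0 then r else sInf {k : ℕ | x ∉ Ideal.span {z ^ (k + 1)}}


theorem aux_unit {R : Type*} [CommRing R] [IsLocalRing R] (z : R)
    (hz : IsLocalRing.maximalIdeal R = Ideal.span {z}) (c : R) : IsUnit (1 - z * c) := by
  have h : z * c ∈ IsLocalRing.maximalIdeal R := by
    rw [hz]; exact Ideal.mul_mem_right _ _ (Ideal.mem_span_singleton_self z)
  by_contra hn
  have h2 : (1 - z * c) ∈ IsLocalRing.maximalIdeal R := (IsLocalRing.mem_maximalIdeal _).2 hn
  have h3 := add_mem h2 h
  rw [sub_add_cancel] at h3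
  exact (IsLocalRing.mem_maximalIdeal _).1 h3 isUnit_one

theorem aux_factor {R : Type*} [CommRing R] [IsLocalRing R] (z : R)
    (hz : IsLocalRing.maximalIdeal R = Ideal.span {z})
    (r : ℕ) (hzr : z ^ r = 0) (x : R) (hx : x ≠ 0) :
    ∃ j, j < r ∧ ∃ u : R, IsUnit u ∧ x = u * z ^ j := by
  have key : ∀ n : ℕ, (∃ j, j < n ∧ ∃ u : R, IsUnit u ∧ x = u * z ^ j) ∨ ∃ u, x = u * z ^ n := by
    intro n
    induction n with
    | zero => right; exact ⟨x, by simp⟩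
    | succ n ih =>
      rcases ih with ⟨j, hj, h⟩ | ⟨u, hu⟩
      · left; exact ⟨j, by omega, h⟩
      · by_cases h : IsUnit u
        · left; exact ⟨n, by omega, u, h, hu⟩
        · right
          have : u ∈ IsLocalRing.maximalIdeal R := (IsLocalRing.mem_maximalIdeal _).2 h
          rw [hz, Ideal.mem_span_singleton'] at this
          obtain ⟨a, rfl⟩ := this
          exact ⟨a, by rw [hu]; ring⟩
  rcases key r with h | ⟨u, hu⟩
  · exact h
  · rw [hzr, mul_zero] at hu; exact absurd hu hx

theorem aux_card {R : Type*} [CommRing R] [Fintype R] [IsLocalRing R]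
    (z : R) (hz : IsLocalRing.maximalIdeal R = Ideal.span {z})
    (r : ℕ) (hzr : z ^ r = 0) (hmin : ∀ k < r, z ^ k ≠ 0)
    (q : ℕ) (hq : Nat.card (IsLocalRing.ResidueField R) = q) (k : ℕ) (hk : k ≤ r) :
    Nat.card {v : R // z ^ k * v = 0} = q ^ k := by
  -- the annihilator of z
  have ann : ∀ x : R, z * x = 0 → ∀ k < r, ∃ v, x = z ^ k * v := by
    intro x hx k hk
    by_cases h0 : x = 0
    · exact ⟨0, by simp [h0]⟩
    obtain ⟨j, hj, u, hu, rfl⟩ := aux_factor z hz r hzr x h0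
    have h1 : z ^ (j + 1) = 0 := by
      apply hu.mul_left_cancel
      rw [mul_zero, ← hx]; ring
    have : ¬ (j + 1 < r) := fun h => hmin _ h h1
    obtain ⟨d, rfl⟩ := Nat.exists_eq_add_of_le (show k ≤ j by omega)
    exact ⟨z ^ d * u, by rw [pow_add]; ring⟩
  have cardA : 0 < r → Nat.card {x : R // z * x = 0} = q := by
    intro hr
    let f : R →ₗ[R] R := LinearMap.mulLeft R (z ^ (r - 1))
    have hker : LinearMap.ker f = IsLocalRing.maximalIdeal R := by
      ext v
      rw [LinearMap.mem_ker, LinearMap.mulLeft_apply]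
      constructor
      · intro h
        rw [IsLocalRing.mem_maximalIdeal]
        intro hv
        exact hmin (r - 1) (by omega) (hv.mul_right_cancel (by rw [h, zero_mul]))
      · intro h
        rw [hz, Ideal.mem_span_singleton'] at h
        obtain ⟨a, rfl⟩ := h
        have : z ^ (r - 1) * (a * z) = z ^ (r - 1 + 1) * a := by ring
        rw [this, Nat.sub_add_cancel hr, hzr, zero_mul]
    have e := f.quotKerEquivRange
    rw [hker] at e
    rw [← hq]
    refine (Nat.card_congr (e.toEquiv.trans (Equiv.subtypeEquivRight ?_))).symm
    intro x
    rw [LinearMap.mem_range]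
    constructor
    · rintro ⟨v, rfl⟩
      rw [LinearMap.mulLeft_apply, ← mul_assoc, ← pow_succ', Nat.sub_add_cancel hr, hzr, zero_mul]
    · intro h
      obtain ⟨v, hv⟩ := ann x h (r - 1) (by omega)
      exact ⟨v, hv.symm⟩
  induction k with
  | zero => simp
  | succ k ih =>
    have ih := ih (by omega)
    have hA := cardA (by omega)
    -- choose preimages
    choose g hg using fun x : {x : R // z * x = 0} => ann x.1 x.2 k (by omega)
    have e : {v : R // z ^ (k + 1) * v = 0} ≃ {v : R // z ^ k * v = 0} × {x : R // z * x = 0} :=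
      { toFun := fun v =>
          let x : {x : R // z * x = 0} := ⟨z ^ k * v.1, by rw [← mul_assoc, ← pow_succ']; exact v.2⟩
          (⟨v.1 - g x, by rw [mul_sub, ← hg x, sub_self]⟩, x)
        invFun := fun p => ⟨p.1.1 + g p.2, by
          rw [pow_succ', mul_assoc, mul_add, ← hg p.2, p.1.2, zero_add, p.2.2]⟩
        left_inv := fun v => by ext; simp
        right_inv := fun p => by
          have h : z ^ k * (p.1.1 + g p.2) = p.2.1 := by rw [mul_add, ← hg p.2, p.1.2, zero_add]
          ext <;> simp [h] }
    rw [Nat.card_congr e, Nat.card_prod, ih, hA, pow_succ]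

/-- For all `w, s` in a finite valuation ring `R`: if `s ∈ (w)` then the equation
`w * v = s` has exactly `q^{ν(w)}` solutions `v`; if `s ∉ (w)` then it has none. -/
theorem stmt_8 {R : Type*} [CommRing R] [Fintype R] [IsLocalRing R] [IsPrincipalIdealRing R]
    (z : R) (hz : IsLocalRing.maximalIdeal R = Ideal.span {z})
    (r : ℕ) (hzr : z ^ r = 0) (hmin : ∀ k < r, z ^ k ≠ 0)
    (q : ℕ) (hq : Nat.card (IsLocalRing.ResidueField R) = q)
    (w s : R) :
    (s ∈ Ideal.span {w} → Nat.card {v : R // w * v = s} = q ^ nuVal z r w) ∧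
      (s ∉ Ideal.span {w} → ¬∃ v : R, w * v = s) := by
  refine ⟨fun hs => ?_, fun hs ⟨v, hv⟩ =>
    hs (Ideal.mem_span_singleton'.2 ⟨v, by rw [mul_comm, hv]⟩)⟩
  obtain ⟨v0, hv0⟩ := Ideal.mem_span_singleton'.1 hs
  have e : {v : R // w * v = s} ≃ {v : R // w * v = 0} :=
    (Equiv.subRight v0).subtypeEquiv fun v => by
      rw [Equiv.subRight_apply, mul_sub, sub_eq_zero, mul_comm w v0, hv0]
  rw [Nat.card_congr e]
  have hc := aux_card z hz r hzr hmin q hq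
  by_cases h0 : w = 0
  · rw [nuVal, if_pos h0, ← hc r le_rfl, h0, hzr]
  · rw [nuVal, if_neg h0]
    obtain ⟨j, hj, u, hu, rfl⟩ := aux_factor z hz r hzr w h0
    have hS : sInf {k : ℕ | u * z ^ j ∉ Ideal.span {z ^ (k + 1)}} = j := by
      apply IsLeast.csInf_eq
      constructor
      · intro hmem
        rw [Ideal.mem_span_singleton'] at hmem
        obtain ⟨a, ha⟩ := hmem
        obtain ⟨t, ht⟩ := hu.exists_left_inv
        apply hmin j hj
        apply (aux_unit z hz (t * a)).mul_left_cancel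
        rw [mul_zero]
        have : (1 - z * (t * a)) * z ^ j
            = (1 - t * u) * z ^ j + t * (u * z ^ j - a * z ^ (j + 1)) := by ring
        rw [this, ht, ha]; ring
      · intro k hk
        by_contra hlt
        apply hk
        exact Ideal.mem_span_singleton.2 (Dvd.dvd.mul_left (pow_dvd_pow z (by omega)) u)
    rw [hS, ← hc j hj.le]
    refine Nat.card_congr (Equiv.subtypeEquivRight fun v => ?_)
    rw [mul_assoc]
    exact hu.mul_right_eq_zero
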